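/- For every r > 0 and every c ∈ ℝ, the double integral ∫_0^∞ ∫_ℝ exp(−2r(x − y))·Ai(x + y + 2c)² dy dx is absolutely convergent and equals exp(2r³/3 − 4cr)/(8·√(2π)·r^{3/2}). -/

import Mathlib

open MeasureTheory

/-- The Airy function, defined by an absolutely convergent contour integral
over the vertical line `Re w = 1`. -/
noncomputable def Ai (x : ℝ) : ℝ :=
  (1 / (2 * Real.pi)) *
    ∫ t : ℝ, (Complex.exp ((1 + (t : ℂ) * Complex.I) ^ 3 / 3
      - (1 + (t : ℂ) * Complex.I) * (x : ℂ))).re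

section GaussianDecay

open Polynomial

lemma iteratedDeriv_cexp_eval (q : ℂ[X]) (n : ℕ) :
    ∃ P : ℂ[X], iteratedDeriv n (fun t : ℝ => Complex.exp (q.eval (t : ℂ))) =
      fun t : ℝ => P.eval (t : ℂ) * Complex.exp (q.eval (t : ℂ)) := by
  induction n with
  | zero => exact ⟨1, by simp⟩
  | succ n ih =>
    obtain ⟨P, hP⟩ := ih
    refine ⟨derivative P + P * derivative q, ?_⟩
    rw [iteratedDeriv_succ, hP]
    funext t
    have hp := P.hasDerivAt (t : ℂ)
    have hq := (q.hasDerivAt (t : ℂ)).cexp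
    refine (hp.mul hq).comp_ofReal.deriv.trans ?_
    simp only [eval_add, eval_mul]
    ring

lemma exists_abs_pow_mul_exp_neg_mul_sq_le {a : ℝ} (ha : 0 < a) (k : ℕ) :
    ∃ C, ∀ t : ℝ, |t| ^ k * Real.exp (-a * t ^ 2) ≤ C := by
  refine ⟨1 + k.factorial / a ^ k, fun t => ?_⟩
  have h1 : |t| ^ k ≤ 1 + (t ^ 2) ^ k := by
    rw [← pow_mul, mul_comm 2 k, pow_mul, ← sq_abs, abs_pow]
    nlinarith [sq_nonneg (|t| ^ k - 1), sq_nonneg (|t| ^ k)]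
  have h2 : (t ^ 2) ^ k ≤ k.factorial / a ^ k * Real.exp (a * t ^ 2) := by
    have := Real.pow_div_factorial_le_exp (a * t ^ 2) (by positivity) k
    rw [mul_pow, div_le_iff₀ (by positivity)] at this
    rw [div_mul_eq_mul_div, le_div_iff₀ (by positivity)]
    linarith
  have h3 : Real.exp (-a * t ^ 2) ≤ 1 := Real.exp_le_one_iff.2 (by nlinarith [sq_nonneg t])
  have h4 : Real.exp (a * t ^ 2) * Real.exp (-a * t ^ 2) = 1 := by
    rw [← Real.exp_add]; simp
  calc |t| ^ k * Real.exp (-a * t ^ 2)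
      ≤ (1 + k.factorial / a ^ k * Real.exp (a * t ^ 2)) * Real.exp (-a * t ^ 2) := by
        gcongr; linarith
    _ = Real.exp (-a * t ^ 2) + k.factorial / a ^ k := by
        rw [add_mul, mul_assoc, h4]; ring
    _ ≤ _ := by linarith

lemma exists_norm_eval_mul_exp_neg_mul_sq_le {a : ℝ} (ha : 0 < a) (P : ℂ[X]) :
    ∃ C, ∀ t : ℝ, ‖P.eval (t : ℂ)‖ * Real.exp (-a * t ^ 2) ≤ C := by
  induction P using Polynomial.induction_on' with
  | add P Q hP hQ =>
    obtain ⟨C, hC⟩ := hP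
    obtain ⟨D, hD⟩ := hQ
    refine ⟨C + D, fun t => ?_⟩
    rw [eval_add]
    calc _ ≤ (‖P.eval (t : ℂ)‖ + ‖Q.eval (t : ℂ)‖) * Real.exp (-a * t ^ 2) := by
          gcongr; exact norm_add_le _ _
      _ ≤ _ := by rw [add_mul]; exact add_le_add (hC t) (hD t)
  | monomial n c =>
    obtain ⟨C, hC⟩ := exists_abs_pow_mul_exp_neg_mul_sq_le ha n
    refine ⟨‖c‖ * C, fun t => ?_⟩
    rw [eval_monomial, norm_mul, norm_pow, Complex.norm_real, Real.norm_eq_abs, mul_assoc]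
    gcongr
    exact hC t

/-- The exponential of a polynomial whose real part on the real line is at most `M - a * t ^ 2`,
as a Schwartz function. -/
noncomputable def schwartzExpPolynomial (q : ℂ[X]) {a M : ℝ} (ha : 0 < a)
    (hq : ∀ t : ℝ, (q.eval (t : ℂ)).re ≤ M - a * t ^ 2) : SchwartzMap ℝ ℂ where
  toFun t := Complex.exp (q.eval (t : ℂ))
  smooth' := by
    have h : ContDiff ℂ (⊤ : ℕ∞) (fun z : ℂ => Complex.exp (q.eval z)) := by
      simpa using (q.contDiff_aeval (𝕜 := ℂ) (⊤ : ℕ∞)).cexp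
    exact (h.restrict_scalars ℝ).comp Complex.ofRealCLM.contDiff
  decay' k n := by
    obtain ⟨P, hP⟩ := iteratedDeriv_cexp_eval q n
    obtain ⟨C, hC⟩ := exists_norm_eval_mul_exp_neg_mul_sq_le ha (X ^ k * P)
    refine ⟨Real.exp M * C, fun t => ?_⟩
    rw [norm_iteratedFDeriv_eq_norm_iteratedDeriv, hP, norm_mul, Complex.norm_exp]
    have h := hC t
    rw [eval_mul, eval_pow, eval_X, norm_mul, norm_pow, Complex.norm_real] at h
    calc ‖t‖ ^ k * (‖P.eval (t : ℂ)‖ * Real.exp (q.eval (t : ℂ)).re)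
        ≤ ‖t‖ ^ k * (‖P.eval (t : ℂ)‖ * Real.exp (M + -a * t ^ 2)) := by
          gcongr; linarith [hq t]
      _ = Real.exp M * (‖t‖ ^ k * ‖P.eval (t : ℂ)‖ * Real.exp (-a * t ^ 2)) := by
          rw [Real.exp_add]; ring
      _ ≤ _ := by gcongr

end GaussianDecay

section AiryContour

open Complex Filter Topology

/-- The integrand of the Airy contour integral. -/
noncomputable def airyIntegrand (u : ℝ) (w : ℂ) : ℂ := exp (w ^ 3 / 3 - w * u)

lemma differentiable_airyIntegrand (u : ℝ) : Differentiable ℂ (airyIntegrand u) := by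
  unfold airyIntegrand
  fun_prop

lemma norm_airyIntegrand (u a t : ℝ) :
    ‖airyIntegrand u (a + t * I)‖ = Real.exp (a ^ 3 / 3 - a * u) * Real.exp (-a * t ^ 2) := by
  have h : ((a : ℂ) + t * I) ^ 3 / 3 - (a + t * I) * u =
      ((a ^ 3 / 3 - a * u + -a * t ^ 2 : ℝ) : ℂ) + ((a ^ 2 * t - t ^ 3 / 3 - t * u : ℝ) : ℂ) * I := by
    push_cast
    linear_combination (a * t ^ 2 + t ^ 3 * I / 3 : ℂ) * I_sq
  rw [airyIntegrand, norm_exp, h, ← Real.exp_add]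
  simp [-ofReal_sub, -ofReal_add, -ofReal_mul]

lemma integrable_airyIntegrand (u : ℝ) {a : ℝ} (ha : 0 < a) :
    Integrable fun t : ℝ => airyIntegrand u (a + t * I) := by
  refine ((integrable_exp_neg_mul_sq ha).const_mul (Real.exp (a ^ 3 / 3 - a * u))).mono' ?_
    (.of_forall fun t => (norm_airyIntegrand u a t).le)
  exact ((differentiable_airyIntegrand u).continuous.comp (by fun_prop)).aestronglyMeasurable

lemma norm_horizontal_airyIntegrand_le (u : ℝ) {a b : ℝ} (ha : 0 < a) (hb : 0 < b) (T : ℝ) :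
    ‖∫ x in a..b, airyIntegrand u (x + T * I)‖ ≤
      Real.exp (max a b ^ 3 / 3 + max a b * |u|) * Real.exp (-min a b * T ^ 2) * |b - a| := by
  refine intervalIntegral.norm_integral_le_of_norm_le_const fun x hx => ?_
  obtain ⟨h1, h2⟩ := hx
  have h0 : 0 < min a b := lt_min ha hb
  have hx0 : 0 < x := h0.trans h1
  rw [norm_airyIntegrand]
  have h3 : -(x * u) ≤ max a b * |u| := by
    calc -(x * u) ≤ x * |u| := by rw [← mul_neg]; gcongr; exact neg_le_abs u
      _ ≤ _ := by gcongr
  have h4 : x ^ 3 ≤ max a b ^ 3 := by gcongr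
  gcongr
  linarith

lemma integral_airyIntegrand_congr (u : ℝ) {a b : ℝ} (ha : 0 < a) (hb : 0 < b) :
    ∫ t : ℝ, airyIntegrand u (a + t * I) = ∫ t : ℝ, airyIntegrand u (b + t * I) := by
  have hrect (T : ℝ) : (∫ t in (-T)..T, airyIntegrand u (b + t * I)) -
      (∫ t in (-T)..T, airyIntegrand u (a + t * I)) =
      I * ((∫ x in a..b, airyIntegrand u (x + (-T : ℝ) * I)) -
        ∫ x in a..b, airyIntegrand u (x + T * I)) := by
    have := integral_boundary_rect_eq_zero_of_differentiableOn (airyIntegrand u)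
      (⟨a, -T⟩ : ℂ) ⟨b, T⟩ (differentiable_airyIntegrand u).differentiableOn
    simp only [smul_eq_mul] at this
    linear_combination (-I) * this + ((∫ t in (-T)..T, airyIntegrand u (b + t * I)) -
      (∫ t in (-T)..T, airyIntegrand u (a + t * I))) * I_sq
  have hlim {c : ℝ} (hc : 0 < c) : Tendsto (fun T : ℝ => ∫ t in (-T)..T, airyIntegrand u (c + t * I))
      atTop (𝓝 (∫ t : ℝ, airyIntegrand u (c + t * I))) :=
    intervalIntegral_tendsto_integral (integrable_airyIntegrand u hc) tendsto_neg_atTop_atBot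
      tendsto_id
  have hzero : Tendsto (fun T : ℝ => (∫ t in (-T)..T, airyIntegrand u (b + t * I)) -
      (∫ t in (-T)..T, airyIntegrand u (a + t * I))) atTop (𝓝 0) := by
    set C := Real.exp (max a b ^ 3 / 3 + max a b * |u|)
    have hexp : Tendsto (fun T : ℝ => Real.exp (-min a b * T ^ 2)) atTop (𝓝 0) :=
      Real.tendsto_exp_atBot.comp ((tendsto_pow_atTop two_ne_zero).const_mul_atTop_of_neg
        (neg_lt_zero.2 (lt_min ha hb)))
    have hbound : Tendsto (fun T : ℝ => 2 * C * |b - a| * Real.exp (-min a b * T ^ 2)) atTop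
        (𝓝 0) := by
      simpa using hexp.const_mul (2 * C * |b - a|)
    refine squeeze_zero_norm (fun T => ?_) hbound
    rw [hrect, norm_mul, norm_I, one_mul]
    have h1 := norm_horizontal_airyIntegrand_le u ha hb T
    have h2 := norm_horizontal_airyIntegrand_le u ha hb (-T)
    rw [neg_sq] at h2
    linarith [norm_sub_le (∫ x in a..b, airyIntegrand u (x + (-T : ℝ) * I))
      (∫ x in a..b, airyIntegrand u (x + T * I))]
  exact (sub_eq_zero.1 (tendsto_nhds_unique ((hlim hb).sub (hlim ha)) hzero)).symm

lemma ofReal_Ai (u : ℝ) {r : ℝ} (hr : 0 < r) :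
    (Ai u : ℂ) = 1 / (2 * Real.pi) * ∫ t : ℝ, airyIntegrand u (r + t * I) := by
  rw [integral_airyIntegrand_congr u hr one_pos]
  have hreal : starRingEnd ℂ (∫ t : ℝ, airyIntegrand u ((1 : ℝ) + t * I)) =
      ∫ t : ℝ, airyIntegrand u ((1 : ℝ) + t * I) := by
    rw [← integral_conj, ← integral_neg_eq_self]
    refine integral_congr_ae (.of_forall fun t => ?_)
    simp [airyIntegrand, ← exp_conj, conj_ofNat]
  rw [← conj_eq_iff_re.1 hreal, Ai]
  have hre := integral_re (integrable_airyIntegrand u one_pos)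
  simp only [RCLike.re_eq_complex_re] at hre
  rw [← hre]
  simp [airyIntegrand]

end AiryContour

section WeightedSecondMoment

open Complex FourierTransform

open Polynomial in
lemma exists_schwartzMap_eq_exp_cube {r : ℝ} (hr : 0 < r) :
    ∃ G : SchwartzMap ℝ ℂ, ∀ t : ℝ, G t = exp ((r + t * I) ^ 3 / 3) := by
  have heval (t : ℝ) : (C (1 / 3 : ℂ) * (C (r : ℂ) + X * C I) ^ 3).eval (t : ℂ) =
      (r + t * I) ^ 3 / 3 := by
    simp only [eval_mul, eval_pow, eval_add, eval_C, eval_X]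
    ring
  have hre (t : ℝ) : ((C (1 / 3 : ℂ) * (C (r : ℂ) + X * C I) ^ 3).eval (t : ℂ)).re ≤
      r ^ 3 / 3 - r * t ^ 2 := by
    have h := norm_airyIntegrand 0 r t
    rw [airyIntegrand, norm_exp, ← Real.exp_add, Real.exp_eq_exp] at h
    rw [heval]
    simp only [ofReal_zero, mul_zero, sub_zero] at h
    linarith
  exact ⟨schwartzExpPolynomial _ hr hre, fun t => congrArg exp (heval t)⟩

lemma exp_mul_Ai_eq_fourier {r : ℝ} (hr : 0 < r) {G : SchwartzMap ℝ ℂ}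
    (hG : ∀ t : ℝ, G t = exp ((r + t * I) ^ 3 / 3)) (u : ℝ) :
    ((Real.exp (r * u) * Ai u : ℝ) : ℂ) = 1 / (2 * Real.pi) * (𝓕 G) (u / (2 * Real.pi)) := by
  rw [ofReal_mul, ofReal_Ai u hr, SchwartzMap.fourier_coe, Real.fourier_real_eq_integral_exp_smul,
    mul_left_comm, ← integral_const_mul]
  congr 1
  refine integral_congr_ae (.of_forall fun t => ?_)
  have hu : -2 * Real.pi * t * (u / (2 * Real.pi)) = -(t * u) := by
    field_simp
  simp only [hu, hG, airyIntegrand, smul_eq_mul, ofReal_exp, ← exp_add]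
  congr 1
  push_cast
  ring

lemma exp_mul_Ai_sq_eq {r : ℝ} (hr : 0 < r) {G : SchwartzMap ℝ ℂ}
    (hG : ∀ t : ℝ, G t = exp ((r + t * I) ^ 3 / 3)) (u : ℝ) :
    Real.exp (2 * r * u) * Ai u ^ 2 =
      (1 / (2 * Real.pi)) ^ 2 * ‖(𝓕 G) (u / (2 * Real.pi))‖ ^ 2 := by
  have h := congrArg (‖·‖ ^ 2) (exp_mul_Ai_eq_fourier hr hG u)
  simp only [norm_real, norm_mul, norm_div, norm_one, Complex.norm_ofNat, mul_pow,
    Real.norm_eq_abs, sq_abs, abs_of_pos Real.pi_pos, Real.abs_exp] at h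
  rw [mul_assoc, two_mul, Real.exp_add, ← sq, h]

lemma integrable_exp_mul_Ai_sq {r : ℝ} (hr : 0 < r) :
    Integrable fun u : ℝ => Real.exp (2 * r * u) * Ai u ^ 2 := by
  obtain ⟨G, hG⟩ := exists_schwartzMap_eq_exp_cube hr
  simp_rw [exp_mul_Ai_sq_eq hr hG]
  exact ((((𝓕 G).memLp 2).integrable_norm_pow two_ne_zero).comp_div
    (by positivity : 2 * Real.pi ≠ 0)).const_mul _

lemma integral_exp_mul_Ai_sq {r : ℝ} (hr : 0 < r) :
    ∫ u : ℝ, Real.exp (2 * r * u) * Ai u ^ 2 =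
      Real.exp (2 * r ^ 3 / 3) / (2 * Real.sqrt (2 * Real.pi * r)) := by
  obtain ⟨G, hG⟩ := exists_schwartzMap_eq_exp_cube hr
  have hnorm (t : ℝ) : ‖G t‖ ^ 2 = Real.exp (2 * r ^ 3 / 3) * Real.exp (-(2 * r) * t ^ 2) := by
    have h := norm_airyIntegrand 0 r t
    simp only [airyIntegrand, ofReal_zero, mul_zero, sub_zero] at h
    rw [hG, h, ← Real.exp_add, ← Real.exp_add, ← Real.exp_nat_mul]
    congr 1
    push_cast
    ring
  have hsqrt : Real.sqrt (Real.pi / (2 * r)) = Real.pi / Real.sqrt (2 * Real.pi * r) := by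
    rw [eq_div_iff (by positivity), ← Real.sqrt_mul (by positivity)]
    rw [show Real.pi / (2 * r) * (2 * Real.pi * r) = Real.pi ^ 2 by field_simp]
    exact Real.sqrt_sq Real.pi_pos.le
  simp_rw [exp_mul_Ai_sq_eq hr hG]
  rw [integral_const_mul, Measure.integral_comp_div (fun ξ : ℝ => ‖(𝓕 G : SchwartzMap ℝ ℂ) ξ‖ ^ 2) (2 * Real.pi),
    SchwartzMap.integral_norm_sq_fourier]
  simp_rw [hnorm]
  rw [integral_const_mul, integral_gaussian, hsqrt, smul_eq_mul, abs_of_pos (by positivity)]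
  field_simp

end WeightedSecondMoment

/-- The squared Hilbert–Schmidt norm of `U_r⁻¹ P₀ B₀,c U_r`:
`∫_0^∞ ∫_ℝ e^{-2r(x-y)} Ai(x+y+2c)² dy dx = e^{2r³/3 - 4cr}/(8 √(2π) r^{3/2})`. -/
theorem hs_norm_P0B (r c : ℝ) (hr : 0 < r) :
    IntegrableOn (fun p : ℝ × ℝ => Real.exp (-2 * r * (p.1 - p.2)) * Ai (p.1 + p.2 + 2 * c) ^ 2)
      (Set.Ioi (0 : ℝ) ×ˢ Set.univ) ∧
    (∫ x in Set.Ioi (0 : ℝ), ∫ y : ℝ, Real.exp (-2 * r * (x - y)) * Ai (x + y + 2 * c) ^ 2)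
      = Real.exp (2 * r ^ 3 / 3 - 4 * c * r) / (8 * Real.sqrt (2 * Real.pi) * r ^ ((3 : ℝ) / 2)) := by
  set h : ℝ → ℝ := fun u => Real.exp (2 * r * u) * Ai u ^ 2
  have hfac (x y : ℝ) : Real.exp (-2 * r * (x - y)) * Ai (x + y + 2 * c) ^ 2 =
      Real.exp (-4 * c * r) * Real.exp (-4 * r * x) * h (x + y + 2 * c) := by
    simp only [h]
    rw [← mul_assoc, ← Real.exp_add, ← Real.exp_add]
    congr 2
    ring
  have hneg : -4 * r < 0 := by linarith
  constructor
  · rw [IntegrableOn, Measure.volume_eq_prod, ← Measure.prod_restrict, Measure.restrict_univ]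
    have hprod := ((integrableOn_exp_mul_Ioi hneg 0).const_mul (Real.exp (-4 * c * r))).mul_prod
      ((integrable_exp_mul_Ai_sq hr).comp_add_right (2 * c))
    refine ((measurePreserving_prod_add (volume.restrict (Set.Ioi (0 : ℝ))) volume).integrable_comp
      hprod.aestronglyMeasurable |>.2 hprod).congr (.of_forall fun p => ?_)
    exact (hfac p.1 p.2).symm
  · have hinner (x : ℝ) : ∫ y : ℝ, Real.exp (-2 * r * (x - y)) * Ai (x + y + 2 * c) ^ 2 =
        Real.exp (-4 * c * r) * (∫ u, h u) * Real.exp (-4 * r * x) := by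
      simp_rw [hfac]
      rw [integral_const_mul, integral_add_left_eq_self (fun y => h (y + 2 * c)),
        integral_add_right_eq_self h]
      ring
    have hsqrt : Real.sqrt (2 * Real.pi * r) = Real.sqrt (2 * Real.pi) * r ^ ((1 : ℝ) / 2) := by
      rw [Real.sqrt_mul (by positivity), Real.sqrt_eq_rpow r]
    have hpow : r ^ ((3 : ℝ) / 2) = r * r ^ ((1 : ℝ) / 2) := by
      rw [← Real.rpow_one_add' hr.le (by norm_num)]
      norm_num
    simp_rw [hinner]
    rw [integral_const_mul, integral_exp_mul_Ioi hneg, integral_exp_mul_Ai_sq hr, hsqrt, hpow,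
      sub_eq_add_neg, Real.exp_add, mul_zero, Real.exp_zero,
      show -(4 * c * r) = -4 * c * r by ring]
    field_simp
    norm_num
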